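/- Fix an integer d ≥ 2 and λ ≥ 0. Let S = {q ∈ [0,1]^{ℕ₀} : q₀ = 1, q_i ≥ q_{i+1} for all i ∈ ℕ₀, and Σ_{i} q_i < ∞}, equipped with the ℓ¹ distance. Suppose q, q̃ : [0,∞) → S are continuous (as maps into ℓ¹) and satisfy, for every i ≥ 1 and t ≥ 0, q_i(t) = q_i(0) + ∫₀^t [λ((q_{i−1}(s))^d − (q_i(s))^d) − (q_i(s) − q_{i+1}(s))] ds and likewise for q̃. If q(0) = q̃(0), then q(t) = q̃(t) for all t ≥ 0. -/

import Mathlib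

open Filter

/-- The drift of coordinate `i` of the power-of-`d` fluid limit at the state `x`. -/
def powerOfDDrift (d : ℕ) (lam : ℝ) (x : ℕ → ℝ) (i : ℕ) : ℝ :=
  lam * ((x (i - 1)) ^ d - (x i) ^ d) - (x i - x (i + 1))

lemma abs_pow_sub_pow_le_of_mem_Icc {a b : ℝ} (ha : a ∈ Set.Icc (0 : ℝ) 1)
    (hb : b ∈ Set.Icc (0 : ℝ) 1) (d : ℕ) : |a ^ d - b ^ d| ≤ d * |a - b| := by
  have hmax : max |a| |b| ^ (d - 1) ≤ 1 := by
    refine pow_le_one₀ (le_max_of_le_left (abs_nonneg a)) (max_le ?_ ?_)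
    · rw [abs_of_nonneg ha.1]; exact ha.2
    · rw [abs_of_nonneg hb.1]; exact hb.2
  calc |a ^ d - b ^ d| ≤ |a - b| * d * max |a| |b| ^ (d - 1) := abs_pow_sub_pow_le a b d
    _ ≤ |a - b| * d * 1 := by gcongr
    _ = d * |a - b| := by ring

/-- The drift is Lipschitz with respect to the uniform distance on `[0, 1]`-valued sequences. -/
lemma abs_powerOfDDrift_sub_le (d : ℕ) {lam : ℝ} (hlam : 0 ≤ lam) {x y : ℕ → ℝ} {M : ℝ}
    (hx : ∀ i, x i ∈ Set.Icc (0 : ℝ) 1) (hy : ∀ i, y i ∈ Set.Icc (0 : ℝ) 1)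
    (hM : ∀ i, |x i - y i| ≤ M) (i : ℕ) :
    |powerOfDDrift d lam x i - powerOfDDrift d lam y i| ≤ (2 * lam * d + 2) * M := by
  have hpow (j : ℕ) : |x j ^ d - y j ^ d| ≤ d * M :=
    (abs_pow_sub_pow_le_of_mem_Icc (hx j) (hy j) d).trans (by gcongr; exact hM j)
  have h₁ := abs_le.1 (hpow (i - 1))
  have h₂ := abs_le.1 (hpow i)
  have h₃ := abs_le.1 (hM i)
  have h₄ := abs_le.1 (hM (i + 1))
  unfold powerOfDDrift
  rw [abs_le]
  constructor
  · linarith [mul_le_mul_of_nonneg_left h₁.1 hlam, mul_le_mul_of_nonneg_left h₂.2 hlam]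
  · linarith [mul_le_mul_of_nonneg_left h₁.2 hlam, mul_le_mul_of_nonneg_left h₂.1 hlam]

/-- A summable-sequence-valued curve that is continuous in `ℓ¹` has continuous coordinates. -/
lemma continuousOn_coord_of_tendsto_tsum_abs {q : ℝ → ℕ → ℝ} {s : Set ℝ}
    (hsum : ∀ t ∈ s, Summable (q t))
    (hcont : ∀ t₀ ∈ s, Tendsto (fun t => ∑' i : ℕ, |q t i - q t₀ i|)
      (nhdsWithin t₀ s) (nhds 0)) (i : ℕ) :
    ContinuousOn (fun t => q t i) s := by
  intro t₀ ht₀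
  refine tendsto_iff_dist_tendsto_zero.2 (squeeze_zero' (Eventually.of_forall fun t => dist_nonneg)
    ?_ (hcont t₀ ht₀))
  filter_upwards [self_mem_nhdsWithin] with t ht
  exact ((hsum t ht).sub (hsum t₀ ht₀)).abs.le_tsum i fun j _ => abs_nonneg _

lemma continuousOn_powerOfDDrift (d : ℕ) (lam : ℝ) {q : ℝ → ℕ → ℝ} {s : Set ℝ}
    (hq : ∀ i, ContinuousOn (fun t => q t i) s) (i : ℕ) :
    ContinuousOn (fun t => powerOfDDrift d lam (q t) i) s :=
  (continuousOn_const.mul (((hq (i - 1)).pow d).sub ((hq i).pow d))).sub ((hq i).sub (hq (i + 1)))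

lemma integral_mul_pow_div_factorial (C t : ℝ) (n : ℕ) :
    ∫ s in (0 : ℝ)..t, C * ((C * s) ^ n / n.factorial) =
      (C * t) ^ (n + 1) / (n + 1).factorial := by
  have h (s : ℝ) : C * ((C * s) ^ n / n.factorial) = C ^ (n + 1) / n.factorial * s ^ n := by
    rw [mul_pow]; ring
  simp only [h, intervalIntegral.integral_const_mul, integral_pow]
  rw [Nat.factorial_succ, mul_pow]
  push_cast
  field_simp
  simp

/-- Two solutions of the fluid-limit equations with the same initial state satisfy the Picard
iteration bounds. -/
lemma abs_sub_le_pow_div_factorial (d : ℕ) {lam : ℝ} (hlam : 0 ≤ lam) {q q' : ℝ → ℕ → ℝ}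
    (hq : ∀ t, 0 ≤ t → ∀ i, q t i ∈ Set.Icc (0 : ℝ) 1)
    (hq' : ∀ t, 0 ≤ t → ∀ i, q' t i ∈ Set.Icc (0 : ℝ) 1)
    (hzero : ∀ t, 0 ≤ t → q t 0 = q' t 0)
    (hc : ∀ i, ContinuousOn (fun t => q t i) (Set.Ici 0))
    (hc' : ∀ i, ContinuousOn (fun t => q' t i) (Set.Ici 0))
    (heq : ∀ i, 1 ≤ i → ∀ t, 0 ≤ t →
      q t i = q 0 i + ∫ s in (0 : ℝ)..t, powerOfDDrift d lam (q s) i)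
    (heq' : ∀ i, 1 ≤ i → ∀ t, 0 ≤ t →
      q' t i = q' 0 i + ∫ s in (0 : ℝ)..t, powerOfDDrift d lam (q' s) i)
    (h0 : q 0 = q' 0) (n : ℕ) {t : ℝ} (ht : 0 ≤ t) (i : ℕ) :
    |q t i - q' t i| ≤ ((2 * lam * d + 2) * t) ^ n / n.factorial := by
  induction n generalizing t i with
  | zero =>
    have h := hq t ht i
    have h' := hq' t ht i
    simp only [pow_zero, Nat.factorial_zero, Nat.cast_one, div_one]
    exact abs_le.2 ⟨by linarith [h.1, h'.2], by linarith [h.2, h'.1]⟩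
  | succ n ih =>
    rcases Nat.eq_zero_or_pos i with rfl | hi
    · rw [hzero t ht, sub_self, abs_zero]
      positivity
    have hsub : Set.uIcc 0 t ⊆ Set.Ici (0 : ℝ) := by
      rw [Set.uIcc_of_le ht]; exact Set.Icc_subset_Ici_self
    have hint := ((continuousOn_powerOfDDrift d lam hc i).mono hsub).intervalIntegrable
      (μ := MeasureTheory.volume)
    have hint' := ((continuousOn_powerOfDDrift d lam hc' i).mono hsub).intervalIntegrable
      (μ := MeasureTheory.volume)
    rw [heq i hi t ht, heq' i hi t ht, h0, add_sub_add_left_eq_sub,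
      ← intervalIntegral.integral_sub hint hint', ← integral_mul_pow_div_factorial,
      ← Real.norm_eq_abs]
    refine intervalIntegral.norm_integral_le_of_norm_le ht (Eventually.of_forall fun s hs => ?_)
      (Continuous.intervalIntegrable (by fun_prop) 0 t)
    exact abs_powerOfDDrift_sub_le d hlam (hq s hs.1.le) (hq' s hs.1.le)
      (fun j => ih hs.1.le j) i

theorem stmt_4 (d : ℕ) (hd : 2 ≤ d) (lam : ℝ) (hlam : 0 ≤ lam)
    (q q' : ℝ → ℕ → ℝ)
    (hS : ∀ t, 0 ≤ t → (∀ i, q t i ∈ Set.Icc (0 : ℝ) 1) ∧ q t 0 = 1 ∧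
        (∀ i, q t (i + 1) ≤ q t i) ∧ Summable (q t))
    (hS' : ∀ t, 0 ≤ t → (∀ i, q' t i ∈ Set.Icc (0 : ℝ) 1) ∧ q' t 0 = 1 ∧
        (∀ i, q' t (i + 1) ≤ q' t i) ∧ Summable (q' t))
    -- continuity of `t ↦ q t` as a map into `ℓ¹`
    (hcont : ∀ t₀, 0 ≤ t₀ → Tendsto (fun t => ∑' i : ℕ, |q t i - q t₀ i|)
        (nhdsWithin t₀ (Set.Ici 0)) (nhds 0))
    (hcont' : ∀ t₀, 0 ≤ t₀ → Tendsto (fun t => ∑' i : ℕ, |q' t i - q' t₀ i|)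
        (nhdsWithin t₀ (Set.Ici 0)) (nhds 0))
    (heq : ∀ i : ℕ, 1 ≤ i → ∀ t, 0 ≤ t →
        q t i = q 0 i + ∫ s in (0 : ℝ)..t,
          (lam * ((q s (i - 1)) ^ d - (q s i) ^ d) - (q s i - q s (i + 1))))
    (heq' : ∀ i : ℕ, 1 ≤ i → ∀ t, 0 ≤ t →
        q' t i = q' 0 i + ∫ s in (0 : ℝ)..t,
          (lam * ((q' s (i - 1)) ^ d - (q' s i) ^ d) - (q' s i - q' s (i + 1))))
    (h0 : q 0 = q' 0) :
    ∀ t, 0 ≤ t → q t = q' t := by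
  have hc := continuousOn_coord_of_tendsto_tsum_abs (s := Set.Ici 0)
    (fun t ht => (hS t ht).2.2.2) hcont
  have hc' := continuousOn_coord_of_tendsto_tsum_abs (s := Set.Ici 0)
    (fun t ht => (hS' t ht).2.2.2) hcont'
  intro t ht
  funext i
  have hbound (n : ℕ) := abs_sub_le_pow_div_factorial d hlam (fun s hs => (hS s hs).1)
    (fun s hs => (hS' s hs).1) (fun s hs => (hS s hs).2.1.trans (hS' s hs).2.1.symm)
    hc hc' heq heq' h0 n ht i
  have hle : |q t i - q' t i| ≤ 0 :=
    ge_of_tendsto' (FloorSemiring.tendsto_pow_div_factorial_atTop _) hbound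
  exact sub_eq_zero.1 (abs_nonpos_iff.1 hle)
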